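/- Let Π be a traditional logic program containing at least one object constant and R a rule in Π. Let x be a non-empty tuple of variables occurring in the body of R but not in its head. If Π' is constructed from Π by replacing R with the result of projecting the variables x out of R using a predicate symbol p that does not occur in Π, then Π' is a conservative extension of Π, i.e., M ↦ M|σ(Π) is a 1-1 correspondence between the answer sets of Π' and the answer sets of Π. -/

import Mathlib

namespace ASP

/-- A first-order signature: predicate symbols and function symbols with arities.
A function symbol of arity 0 is an object constant. -/
structure Signature where
  PredSym : Type
  FunSym : Type
  predArity : PredSym → ℕ
  funArity : FunSym → ℕ

variable {σ : Signature}

/-- First-order terms over a signature, with variables indexed by natural numbers. -/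
inductive Term (σ : Signature) : Type
  | var : ℕ → Term σ
  | fn : (f : σ.FunSym) → (Fin (σ.funArity f) → Term σ) → Term σ

/-- Function symbols occurring in a term. -/
def Term.funs : Term σ → Set σ.FunSym
  | .var _ => ∅
  | .fn f a => insert f (⋃ i, (a i).funs)

/-- Variables occurring in a term. -/
def Term.fv : Term σ → Set ℕ
  | .var n => {n}
  | .fn _ a => ⋃ i, (a i).fv

/-- First-order formulas (with equality) over a signature. -/
inductive Formula (σ : Signature) : Type
  | falsum
  | pred (p : σ.PredSym) (args : Fin (σ.predArity p) → Term σ)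
  | eq (t u : Term σ)
  | and (F G : Formula σ)
  | or (F G : Formula σ)
  | imp (F G : Formula σ)
  | all (x : ℕ) (F : Formula σ)
  | ex (x : ℕ) (F : Formula σ)

/-- `¬F` abbreviates `F → ⊥`. -/
def Formula.neg (F : Formula σ) : Formula σ := .imp F .falsum

/-- `⊤` abbreviates `⊥ → ⊥`. -/
def Formula.top : Formula σ := .imp .falsum .falsum

/-- Predicate symbols occurring in a formula (equality is not a predicate symbol). -/
def Formula.preds : Formula σ → Set σ.PredSym
  | .falsum => ∅
  | .pred p _ => {p}
  | .eq _ _ => ∅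
  | .and F G => F.preds ∪ G.preds
  | .or F G => F.preds ∪ G.preds
  | .imp F G => F.preds ∪ G.preds
  | .all _ F => F.preds
  | .ex _ F => F.preds

/-- Function symbols occurring in a formula. -/
def Formula.funs : Formula σ → Set σ.FunSym
  | .falsum => ∅
  | .pred _ a => ⋃ i, (a i).funs
  | .eq t u => t.funs ∪ u.funs
  | .and F G => F.funs ∪ G.funs
  | .or F G => F.funs ∪ G.funs
  | .imp F G => F.funs ∪ G.funs
  | .all _ F => F.funs
  | .ex _ F => F.funs

/-- A set of symbols of a signature (a "sub-signature"). -/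
structure SymSet (σ : Signature) where
  preds : Set σ.PredSym
  funs : Set σ.FunSym

instance : Union (SymSet σ) := ⟨fun S T => ⟨S.preds ∪ T.preds, S.funs ∪ T.funs⟩⟩

/-- The signature `σ(F)` of a formula: all function and predicate symbols occurring
in it (equality excluded). -/
def Formula.syms (F : Formula σ) : SymSet σ := ⟨F.preds, F.funs⟩

/-- An interpretation over the symbols in `S`: a nonempty universe, together with
interpretations of the function and predicate symbols; symbols outside `S` are given
fixed default values, so that an interpretation is determined by its values on `S`. -/
structure SInterp (σ : Signature) (S : SymSet σ) where
  U : Type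
  ne : Nonempty U
  funI : (f : σ.FunSym) → (Fin (σ.funArity f) → U) → U
  predI : (p : σ.PredSym) → (Fin (σ.predArity p) → U) → Prop
  fun_default : ∀ f ∉ S.funs, ∀ a, funI f a = Classical.choice ne
  pred_default : ∀ p ∉ S.preds, ∀ a, predI p a = False

open Classical in
/-- The restriction `M|T` of an interpretation to the symbol set `T`. -/
noncomputable def SInterp.restrict {S : SymSet σ} (M : SInterp σ S) (T : SymSet σ) :
    SInterp σ T where
  U := M.U
  ne := M.ne
  funI f a := if f ∈ T.funs then M.funI f a else Classical.choice M.ne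
  predI p a := p ∈ T.preds ∧ M.predI p a
  fun_default := by intro f hf a; simp [hf]
  pred_default := by intro p hp a; simp [hp]

/-- Value of a term in an interpretation under a valuation. -/
def Term.eval {S : SymSet σ} (M : SInterp σ S) (v : ℕ → M.U) : Term σ → M.U
  | .var n => v n
  | .fn f a => M.funI f (fun i => (a i).eval M v)

/-- Tarskian satisfaction of a formula. -/
def Sat {S : SymSet σ} (M : SInterp σ S) (v : ℕ → M.U) : Formula σ → Prop
  | .falsum => False
  | .pred p a => M.predI p (fun i => (a i).eval M v)
  | .eq t u => t.eval M v = u.eval M v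
  | .and F G => Sat M v F ∧ Sat M v G
  | .or F G => Sat M v F ∨ Sat M v G
  | .imp F G => Sat M v F → Sat M v G
  | .all x F => ∀ d, Sat M (Function.update v x d) F
  | .ex x F => ∃ d, Sat M (Function.update v x d) F

/-- An assignment of relations to the predicate symbols (used for the tuple `u`
of predicate variables in the operator SM). -/
def PredAssign (σ : Signature) (U : Type) := (p : σ.PredSym) → (Fin (σ.predArity p) → U) → Prop

/-- Satisfaction of `F^*(u)`, the Ferraris–Lee–Lifschitz transformation of `F`,
where `P` is the set of intensional predicates and `u` interprets the corresponding
predicate variables. -/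
def SatStar {S : SymSet σ} (M : SInterp σ S) (u : PredAssign σ M.U) (P : Set σ.PredSym)
    (v : ℕ → M.U) : Formula σ → Prop
  | .falsum => False
  | .pred p a =>
      (p ∈ P ∧ u p (fun i => (a i).eval M v)) ∨ (p ∉ P ∧ M.predI p (fun i => (a i).eval M v))
  | .eq t s => t.eval M v = s.eval M v
  | .and F G => SatStar M u P v F ∧ SatStar M u P v G
  | .or F G => SatStar M u P v F ∨ SatStar M u P v G
  | .imp F G => (SatStar M u P v F → SatStar M u P v G) ∧ (Sat M v F → Sat M v G)
  | .all x F => ∀ d, SatStar M u P (Function.update v x d) F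
  | .ex x F => ∃ d, SatStar M u P (Function.update v x d) F

/-- `u < p`: the tuple `u` is pointwise contained in the intensional predicates `P`
of `M`, and not conversely. -/
def uLt {S : SymSet σ} (M : SInterp σ S) (P : Set σ.PredSym) (u : PredAssign σ M.U) : Prop :=
  (∀ p ∈ P, ∀ a, u p a → M.predI p a) ∧ ¬(∀ p ∈ P, ∀ a, M.predI p a → u p a)

/-- `M` is a `P`-stable model of the (first-order) formula `F`, i.e. `M` satisfies
`SM_P[F] = F ∧ ¬∃u((u < P) ∧ F^*(u))` (formulas are read as their universal closures,
hence the quantification over valuations). -/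
def Formula.PStable {S : SymSet σ} (P : Set σ.PredSym) (F : Formula σ) (M : SInterp σ S) : Prop :=
  (∀ v, Sat M v F) ∧ ¬∃ u : PredAssign σ M.U, uLt M P u ∧ ∀ v, SatStar M u P v F

/-- An atomic formula headed by a predicate symbol (no equality allowed). -/
def PAtom (σ : Signature) := Σ p : σ.PredSym, Fin (σ.predArity p) → Term σ

/-- An atomic formula: a predicate symbol applied to terms, or an equality. -/
inductive Atom (σ : Signature)
  | pred (p : σ.PredSym) (args : Fin (σ.predArity p) → Term σ)
  | eq (t u : Term σ)

def PAtom.toFormula (a : PAtom σ) : Formula σ := .pred a.1 a.2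

def Atom.toFormula : Atom σ → Formula σ
  | .pred p a => .pred p a
  | .eq t u => .eq t u

/-- A rule `a₁ ; … ; a_k ← a_{k+1}, …, a_l, not a_{l+1}, …, not a_m,
not not a_{m+1}, …, not not a_n`: the head atoms and the doubly negated atoms may
not contain equality. -/
structure Rule (σ : Signature) where
  head : List (PAtom σ)
  pos : List (Atom σ)
  neg : List (Atom σ)
  nneg : List (PAtom σ)

def listAnd (l : List (Formula σ)) : Formula σ := l.foldr .and .top
def listOr (l : List (Formula σ)) : Formula σ := l.foldr .or .falsum

/-- The quantifier-free first-order implication corresponding to a rule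
(its universal closure is taken by all semantic notions below). -/
def Rule.toOpen (R : Rule σ) : Formula σ :=
  .imp (listAnd (R.pos.map Atom.toFormula ++ R.neg.map (fun a => a.toFormula.neg) ++
          R.nneg.map (fun a => a.toFormula.neg.neg)))
       (listOr (R.head.map PAtom.toFormula))

/-- A traditional logic program: a finite set (list) of rules, viewed as the
conjunction of the universal closures of the corresponding implications. -/
abbrev Program (σ : Signature) := List (Rule σ)

/-- `π(Π)`: predicate symbols occurring in a program. -/
def Program.preds (Pg : Program σ) : Set σ.PredSym := {p | ∃ R ∈ Pg, p ∈ R.toOpen.preds}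

/-- Function symbols occurring in a program. -/
def Program.funs (Pg : Program σ) : Set σ.FunSym := {f | ∃ R ∈ Pg, f ∈ R.toOpen.funs}

/-- `σ(Π)`: the signature of a program. -/
def Program.syms (Pg : Program σ) : SymSet σ := ⟨Pg.preds, Pg.funs⟩

/-- `M` is a `P`-stable model of the program `Pg` viewed as a first-order formula
(the conjunction of the universal closures of its rules), i.e. `M ⊨ SM_P[Π]`. -/
def Program.PStable {S : SymSet σ} (P : Set σ.PredSym) (Pg : Program σ) (M : SInterp σ S) : Prop :=
  (∀ R ∈ Pg, ∀ v, Sat M v R.toOpen) ∧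
  ¬∃ u : PredAssign σ M.U, uLt M P u ∧ ∀ R ∈ Pg, ∀ v, SatStar M u P v R.toOpen


/-- A class of models `MBig` (over symbols `SG`) is a *conservative extension* of a
class of models `MSmall` (over symbols `SF`) if `M ↦ M|SF` is a 1-1 correspondence
between `MBig` and `MSmall`. -/
def ConsExt {SG SF : SymSet σ} (MBig : Set (SInterp σ SG)) (MSmall : Set (SInterp σ SF)) :
    Prop :=
  (∀ M ∈ MBig, M.restrict SF ∈ MSmall) ∧
  ∀ N ∈ MSmall, ∃! M : SInterp σ SG, M ∈ MBig ∧ M.restrict SF = N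

/-- Ground terms formed from the function symbols (and object constants) in `Fs`. -/
inductive GTerm (σ : Signature) (Fs : Set σ.FunSym) : Type
  | fn (f : σ.FunSym) (hf : f ∈ Fs) (args : Fin (σ.funArity f) → GTerm σ Fs) : GTerm σ Fs

theorem gterm_nonempty {Fs : Set σ.FunSym} (hc : ∃ f ∈ Fs, σ.funArity f = 0) :
    Nonempty (GTerm σ Fs) := by
  obtain ⟨f, hf, h0⟩ := hc
  exact ⟨GTerm.fn f hf (fun i => (Fin.cast h0 i).elim0)⟩

/-- Ground atoms over the symbol set `S`: a predicate symbol of `S` applied to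
ground terms over the function symbols of `S`. -/
def HAtom (σ : Signature) (S : SymSet σ) :=
  {pa : Σ p : σ.PredSym, Fin (σ.predArity p) → GTerm σ S.funs // pa.1 ∈ S.preds}

open Classical in
/-- The Herbrand interpretation of the symbol set `S` determined by a set `X` of
ground atoms: its universe is the set of ground terms over the function symbols of
`S`, function symbols are interpreted as term constructors, and the extension of the
predicates is given by `X`. -/
noncomputable def herbInterp (S : SymSet σ) (ne : Nonempty (GTerm σ S.funs))
    (X : Set (HAtom σ S)) : SInterp σ S where
  U := GTerm σ S.funs
  ne := ne
  funI f a := if hf : f ∈ S.funs then GTerm.fn f hf a else Classical.choice ne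
  predI p a := ∃ hp : p ∈ S.preds, (⟨⟨p, a⟩, hp⟩ : HAtom σ S) ∈ X
  fun_default := by intro f hf a; simp [hf]
  pred_default := by
    intro p hp a
    simp only [eq_iff_iff, iff_false]
    rintro ⟨h, _⟩; exact hp h

/-- `X` is an answer set of the program `Pg` (relative to the symbol set `S`): `X` is
a stable model (in the sense of Ferraris 2005, with every ground atom intensional) of
the grounding of `Pg`, where grounding replaces each rule by all its instances over
ground terms (here: all valuations into the Herbrand universe) and replaces each
ground equality `t₁ = t₂` by `⊤` if `t₁` and `t₂` are identical and by `⊥` otherwise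
(here: equality evaluated in the Herbrand universe). -/
def IsAnswerSet (S : SymSet σ) (ne : Nonempty (GTerm σ S.funs)) (Pg : Program σ)
    (X : Set (HAtom σ S)) : Prop :=
  (∀ R ∈ Pg, ∀ v : ℕ → GTerm σ S.funs, Sat (herbInterp S ne X) v R.toOpen) ∧
  ¬∃ Y : Set (HAtom σ S), Y ⊂ X ∧
    ∀ R ∈ Pg, ∀ v : ℕ → GTerm σ S.funs,
      SatStar (herbInterp S ne X)
        (fun p a => ∃ hp : p ∈ S.preds, (⟨⟨p, a⟩, hp⟩ : HAtom σ S) ∈ Y)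
        Set.univ v R.toOpen

/-- The answer sets of a program, viewed as Herbrand interpretations of `σ(Pg)`. -/
def Program.AnswerModels (Pg : Program σ) : Set (SInterp σ Pg.syms) :=
  {M | ∃ (ne : Nonempty (GTerm σ Pg.syms.funs)) (X : Set (HAtom σ Pg.syms)),
        M = herbInterp Pg.syms ne X ∧ IsAnswerSet Pg.syms ne Pg X}

/-- Variables occurring in an atomic formula without equality. -/
def PAtom.fv (a : PAtom σ) : Set ℕ := ⋃ i, (a.2 i).fv

/-- Variables occurring in an atomic formula. -/
def Atom.fv : Atom σ → Set ℕ
  | .pred _ a => ⋃ i, (a i).fv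
  | .eq t u => t.fv ∪ u.fv

/-- Variables occurring in the head of a rule. -/
def Rule.headVars (R : Rule σ) : Set ℕ := {v | ∃ a ∈ R.head, v ∈ a.fv}

/-- Variables occurring in the body of a rule. -/
def Rule.bodyVars (R : Rule σ) : Set ℕ :=
  {v | (∃ a ∈ R.pos, v ∈ a.fv) ∨ (∃ a ∈ R.neg, v ∈ a.fv) ∨ (∃ a ∈ R.nneg, v ∈ a.fv)}

/-- The variables `y`: all variables occurring in the conjunctive terms of the body
of `R` that contain at least one variable from `xs` (the part `α(x,y)`), but not
occurring in `xs`. -/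
def Rule.alphaVars (R : Rule σ) (xs : Set ℕ) : Set ℕ :=
  {v | v ∉ xs ∧
    ((∃ a ∈ R.pos, v ∈ a.fv ∧ (a.fv ∩ xs).Nonempty) ∨
     (∃ a ∈ R.neg, v ∈ a.fv ∧ (a.fv ∩ xs).Nonempty) ∨
     (∃ a ∈ R.nneg, v ∈ a.fv ∧ (a.fv ∩ xs).Nonempty))}

open Classical in
/-- The result of projecting the variables `xs` out of the rule `R` using the
predicate symbol `t` (whose argument tuple is the list `ys` of variables): the pair
of rules `∀̃((t(y) ∧ β) → γ)` and `∀ x y (α(x,y) → t(y))`, where `α(x,y)` is the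
conjunction of the conjunctive terms of the body of `R` containing at least one
variable from `xs`, `β` the conjunction of the remaining conjunctive terms of the
body, and `γ` the head of `R`. -/
noncomputable def Rule.project (R : Rule σ) (xs : Set ℕ) (t : σ.PredSym) (ys : List ℕ)
    (har : σ.predArity t = ys.length) : Rule σ × Rule σ :=
  let targs : Fin (σ.predArity t) → Term σ := fun i => Term.var (ys.get (Fin.cast har i))
  ( { head := R.head
    , pos := Atom.pred t targs :: R.pos.filter (fun a => decide ¬(a.fv ∩ xs).Nonempty)
    , neg := R.neg.filter (fun a => decide ¬(a.fv ∩ xs).Nonempty)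
    , nneg := R.nneg.filter (fun a => decide ¬(a.fv ∩ xs).Nonempty) }
  , { head := [⟨t, targs⟩]
    , pos := R.pos.filter (fun a => decide (a.fv ∩ xs).Nonempty)
    , neg := R.neg.filter (fun a => decide (a.fv ∩ xs).Nonempty)
    , nneg := R.nneg.filter (fun a => decide (a.fv ∩ xs).Nonempty) } )

/-! ### Symbols of rules and projections -/

theorem mem_preds_listAnd {p : σ.PredSym} {l : List (Formula σ)} :
    p ∈ (listAnd l).preds ↔ ∃ F ∈ l, p ∈ F.preds := by
  induction l with
  | nil => simp [listAnd, Formula.top, Formula.preds]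
  | cons F l ih =>
    have h : listAnd (F :: l) = .and F (listAnd l) := rfl
    simp [h, Formula.preds, ih]

theorem mem_preds_listOr {p : σ.PredSym} {l : List (Formula σ)} :
    p ∈ (listOr l).preds ↔ ∃ F ∈ l, p ∈ F.preds := by
  induction l with
  | nil => simp [listOr, Formula.preds]
  | cons F l ih =>
    have h : listOr (F :: l) = .or F (listOr l) := rfl
    simp [h, Formula.preds, ih]

theorem mem_funs_listAnd {f : σ.FunSym} {l : List (Formula σ)} :
    f ∈ (listAnd l).funs ↔ ∃ F ∈ l, f ∈ F.funs := by
  induction l with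
  | nil => simp [listAnd, Formula.top, Formula.funs]
  | cons F l ih =>
    have h : listAnd (F :: l) = .and F (listAnd l) := rfl
    simp [h, Formula.funs, ih]

theorem mem_funs_listOr {f : σ.FunSym} {l : List (Formula σ)} :
    f ∈ (listOr l).funs ↔ ∃ F ∈ l, f ∈ F.funs := by
  induction l with
  | nil => simp [listOr, Formula.funs]
  | cons F l ih =>
    have h : listOr (F :: l) = .or F (listOr l) := rfl
    simp [h, Formula.funs, ih]

theorem Rule.mem_preds_toOpen {p : σ.PredSym} {R : Rule σ} :
    p ∈ R.toOpen.preds ↔ (∃ a ∈ R.pos, p ∈ a.toFormula.preds) ∨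
      (∃ a ∈ R.neg, p ∈ a.toFormula.preds) ∨ (∃ a ∈ R.nneg, p ∈ a.toFormula.preds) ∨
      (∃ a ∈ R.head, p ∈ a.toFormula.preds) := by
  simp only [Rule.toOpen, Formula.preds, Set.mem_union, mem_preds_listAnd, mem_preds_listOr,
    List.mem_append, List.mem_map, or_and_right, exists_or, exists_exists_and_eq_and, or_assoc,
    Formula.neg, Set.mem_empty_iff_false, or_false]

theorem Rule.mem_funs_toOpen {f : σ.FunSym} {R : Rule σ} :
    f ∈ R.toOpen.funs ↔ (∃ a ∈ R.pos, f ∈ a.toFormula.funs) ∨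
      (∃ a ∈ R.neg, f ∈ a.toFormula.funs) ∨ (∃ a ∈ R.nneg, f ∈ a.toFormula.funs) ∨
      (∃ a ∈ R.head, f ∈ a.toFormula.funs) := by
  simp only [Rule.toOpen, Formula.funs, Set.mem_union, mem_funs_listAnd, mem_funs_listOr,
    List.mem_append, List.mem_map, or_and_right, exists_or, exists_exists_and_eq_and, or_assoc,
    Formula.neg, Set.mem_empty_iff_false, or_false]

theorem exists_mem_iff_filter {α : Type*} (l : List α) (q : α → Prop) [DecidablePred q]
    (P : α → Prop) :
    (∃ a ∈ l, P a) ↔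
      (∃ a ∈ l.filter (fun a => decide (q a)), P a) ∨
        ∃ a ∈ l.filter (fun a => decide ¬q a), P a := by
  simp only [List.mem_filter, decide_eq_true_eq, ← exists_or]
  refine exists_congr fun a => ?_
  tauto

theorem forall_mem_iff_filter {α : Type*} (l : List α) (q : α → Prop) [DecidablePred q]
    (P : α → Prop) :
    (∀ a ∈ l, P a) ↔
      (∀ a ∈ l.filter (fun a => decide (q a)), P a) ∧
        ∀ a ∈ l.filter (fun a => decide ¬q a), P a := by
  simp only [List.mem_filter, decide_eq_true_eq, ← forall_and]
  refine forall_congr' fun a => ?_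
  tauto

section ProjectSymbols

variable (R : Rule σ) (xs : Set ℕ) (t : σ.PredSym) (ys : List ℕ)
  (har : σ.predArity t = ys.length)

theorem Rule.exists_mem_head_project_snd {P : PAtom σ → Prop} :
    (∃ a ∈ (R.project xs t ys har).2.head, P a) ↔
      P ⟨t, fun i => Term.var (ys.get (Fin.cast har i))⟩ :=
  ⟨fun ⟨_, ha, h⟩ => List.mem_singleton.1 ha ▸ h, fun h => ⟨_, List.mem_singleton.2 rfl, h⟩⟩

open Classical in
theorem Rule.mem_preds_project (p : σ.PredSym) :
    (p ∈ (R.project xs t ys har).1.toOpen.preds ∨ p ∈ (R.project xs t ys har).2.toOpen.preds) ↔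
      p = t ∨ p ∈ R.toOpen.preds := by
  have hpos := exists_mem_iff_filter R.pos (fun a => (a.fv ∩ xs).Nonempty)
    (fun a => p ∈ a.toFormula.preds)
  have hneg := exists_mem_iff_filter R.neg (fun a => (a.fv ∩ xs).Nonempty)
    (fun a => p ∈ a.toFormula.preds)
  have hnneg := exists_mem_iff_filter R.nneg (fun a => (a.fv ∩ xs).Nonempty)
    (fun a => p ∈ a.toFormula.preds)
  simp only [Rule.mem_preds_toOpen, Rule.exists_mem_head_project_snd]
  rw [hpos, hneg, hnneg]
  clear hpos hneg hnneg
  simp only [Rule.project, List.mem_cons, or_and_right, exists_or, exists_eq_left, Atom.toFormula,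
    PAtom.toFormula, Formula.preds, Set.mem_singleton_iff]
  grind

open Classical in
theorem Rule.mem_funs_project (f : σ.FunSym) :
    (f ∈ (R.project xs t ys har).1.toOpen.funs ∨ f ∈ (R.project xs t ys har).2.toOpen.funs) ↔
      f ∈ R.toOpen.funs := by
  have hpos := exists_mem_iff_filter R.pos (fun a => (a.fv ∩ xs).Nonempty)
    (fun a => f ∈ a.toFormula.funs)
  have hneg := exists_mem_iff_filter R.neg (fun a => (a.fv ∩ xs).Nonempty)
    (fun a => f ∈ a.toFormula.funs)
  have hnneg := exists_mem_iff_filter R.nneg (fun a => (a.fv ∩ xs).Nonempty)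
    (fun a => f ∈ a.toFormula.funs)
  simp only [Rule.mem_funs_toOpen, Rule.exists_mem_head_project_snd]
  rw [hpos, hneg, hnneg]
  clear hpos hneg hnneg
  simp only [Rule.project, List.mem_cons, or_and_right, exists_or, exists_eq_left, Atom.toFormula,
    PAtom.toFormula, Formula.funs, Term.funs, Set.iUnion_empty,
    Set.mem_empty_iff_false, or_false, false_or]
  grind

end ProjectSymbols

/-! ### Here-and-there semantics of rules -/

/-- Interpretations of the function symbols in the universe `U`. -/
abbrev FunAssign (σ : Signature) (U : Type) := (f : σ.FunSym) → (Fin (σ.funArity f) → U) → U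

section HereThere

variable {U : Type} (φ : FunAssign σ U)

/-- Value of a term under an interpretation of the function symbols. -/
def Term.value (v : ℕ → U) : Term σ → U
  | .var n => v n
  | .fn f a => φ f (fun i => (a i).value v)

theorem Term.value_congr {v w : ℕ → U} (s : Term σ) (h : ∀ n ∈ s.fv, v n = w n) :
    s.value φ v = s.value φ w := by
  induction s with
  | var n => exact h n rfl
  | fn f a ih =>
    simp only [Term.value]
    congr 1
    funext i
    exact ih i fun n hn => h n (Set.mem_iUnion.2 ⟨i, hn⟩)

/-- Truth of an atom without equality. -/
def PAtom.Holds (I : PredAssign σ U) (v : ℕ → U) (a : PAtom σ) : Prop :=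
  I a.1 fun i => (a.2 i).value φ v

/-- Truth of an atom. -/
def Atom.Holds (I : PredAssign σ U) (v : ℕ → U) : Atom σ → Prop
  | .pred p a => I p fun i => (a i).value φ v
  | .eq s u => s.value φ v = u.value φ v

/-- Truth of the body of a rule in the here-world `H` below the there-world `J`. -/
def Rule.Body (J H : PredAssign σ U) (v : ℕ → U) (R : Rule σ) : Prop :=
  (∀ a ∈ R.pos, a.Holds φ H v) ∧ (∀ a ∈ R.neg, ¬a.Holds φ J v) ∧ ∀ a ∈ R.nneg, a.Holds φ J v

/-- Truth of the head of a rule. -/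
def Rule.Head (H : PredAssign σ U) (v : ℕ → U) (R : Rule σ) : Prop :=
  ∃ a ∈ R.head, a.Holds φ H v

/-- Every instance of the rule holds in the world `H` below the world `J`. -/
def Rule.HT (J H : PredAssign σ U) (R : Rule σ) : Prop :=
  ∀ v, R.Body φ J H v → R.Head φ H v

/-- Pointwise inclusion of predicate assignments. -/
def PredLE (H J : PredAssign σ U) : Prop := ∀ p a, H p a → J p a

/-- `J` is a model of the program and no smaller `H` satisfies it below `J`. -/
def Program.HTStable (Pg : Program σ) (J : PredAssign σ U) : Prop :=
  (∀ R ∈ Pg, R.HT φ J J) ∧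
    ¬∃ H, PredLE H J ∧ ¬PredLE J H ∧ ∀ R ∈ Pg, R.HT φ J H

variable {φ}

theorem PAtom.holds_congr_val {I : PredAssign σ U} {v w : ℕ → U} {a : PAtom σ}
    (h : ∀ n ∈ a.fv, v n = w n) : a.Holds φ I v ↔ a.Holds φ I w := by
  unfold PAtom.Holds
  rw [funext fun i => (a.2 i).value_congr φ fun n hn => h n (Set.mem_iUnion.2 ⟨i, hn⟩)]

theorem Atom.holds_congr_val {I : PredAssign σ U} {v w : ℕ → U} {a : Atom σ}
    (h : ∀ n ∈ a.fv, v n = w n) : a.Holds φ I v ↔ a.Holds φ I w := by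
  cases a with
  | pred p a =>
    simp only [Atom.Holds]
    rw [funext fun i => (a i).value_congr φ fun n hn => h n (Set.mem_iUnion.2 ⟨i, hn⟩)]
  | eq s u =>
    simp only [Atom.Holds]
    rw [s.value_congr φ fun n hn => h n (Or.inl hn), u.value_congr φ fun n hn => h n (Or.inr hn)]

theorem Atom.Holds.mono {I J : PredAssign σ U} (h : PredLE I J) {v : ℕ → U} {a : Atom σ}
    (ha : a.Holds φ I v) : a.Holds φ J v := by
  cases a with
  | pred p a => exact h _ _ ha
  | eq s u => exact ha

theorem Rule.Body.mono {J H H' : PredAssign σ U} (h : PredLE H H') {v : ℕ → U} {R : Rule σ}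
    (hR : R.Body φ J H v) : R.Body φ J H' v :=
  ⟨fun a ha => (hR.1 a ha).mono h, hR.2⟩

/-- The two assignments coincide on all predicate symbols other than `t`. -/
def AgreeOff (t : σ.PredSym) (I J : PredAssign σ U) : Prop := ∀ p ≠ t, ∀ a, I p a ↔ J p a

theorem AgreeOff.symm {t : σ.PredSym} {I J : PredAssign σ U} (h : AgreeOff t I J) :
    AgreeOff t J I := fun p hp a => (h p hp a).symm

theorem AgreeOff.refl (t : σ.PredSym) (I : PredAssign σ U) : AgreeOff t I I :=
  fun _ _ _ => Iff.rfl

section Fresh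

variable {t : σ.PredSym}

theorem AgreeOff.pAtom_holds {I J : PredAssign σ U} (h : AgreeOff t I J) {v : ℕ → U}
    {a : PAtom σ} (ha : t ∉ a.toFormula.preds) : a.Holds φ I v ↔ a.Holds φ J v :=
  h _ (fun e => ha (by simp [PAtom.toFormula, Formula.preds, e])) _

theorem AgreeOff.atom_holds {I J : PredAssign σ U} (h : AgreeOff t I J) {v : ℕ → U}
    {a : Atom σ} (ha : t ∉ a.toFormula.preds) : a.Holds φ I v ↔ a.Holds φ J v := by
  cases a with
  | pred p a => exact h _ (fun e => ha (by simp [Atom.toFormula, Formula.preds, e])) _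
  | eq s u => exact Iff.rfl

/-- `t` does not occur in the body of the rule. -/
def Rule.BodyFresh (t : σ.PredSym) (R : Rule σ) : Prop :=
  (∀ a ∈ R.pos, t ∉ a.toFormula.preds) ∧ (∀ a ∈ R.neg, t ∉ a.toFormula.preds) ∧
    ∀ a ∈ R.nneg, t ∉ a.toFormula.preds

theorem Rule.bodyFresh_of_notMem {R : Rule σ} (h : t ∉ R.toOpen.preds) : R.BodyFresh t := by
  rw [Rule.mem_preds_toOpen] at h
  push Not at h
  exact ⟨h.1, h.2.1, h.2.2.1⟩

theorem AgreeOff.body {J J' H H' : PredAssign σ U} (hJ : AgreeOff t J J')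
    (hH : AgreeOff t H H') {v : ℕ → U} {R : Rule σ} (hR : R.BodyFresh t) :
    R.Body φ J H v ↔ R.Body φ J' H' v := by
  obtain ⟨h1, h2, h3⟩ := hR
  exact and_congr (forall₂_congr fun a ha => hH.atom_holds (h1 a ha))
    (and_congr (forall₂_congr fun a ha => not_congr (hJ.atom_holds (h2 a ha)))
      (forall₂_congr fun a ha => hJ.pAtom_holds (h3 a ha)))

theorem AgreeOff.head {H H' : PredAssign σ U} (hH : AgreeOff t H H') {v : ℕ → U} {R : Rule σ}
    (hR : t ∉ R.toOpen.preds) : R.Head φ H v ↔ R.Head φ H' v := by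
  rw [Rule.mem_preds_toOpen] at hR
  push Not at hR
  exact exists_congr fun a => and_congr_right fun ha => hH.pAtom_holds (hR.2.2.2 a ha)

theorem AgreeOff.ht {J J' H H' : PredAssign σ U} (hJ : AgreeOff t J J')
    (hH : AgreeOff t H H') {R : Rule σ} (hR : t ∉ R.toOpen.preds) :
    R.HT φ J H ↔ R.HT φ J' H' :=
  forall_congr' fun _ =>
    imp_congr (hJ.body hH (Rule.bodyFresh_of_notMem hR)) (hH.head hR)

end Fresh

/-! ### Projection in the here-and-there semantics -/

/-- The arguments of the predicate `t` at the variables `ys`. -/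
def tupleAt {t : σ.PredSym} {ys : List ℕ} (har : σ.predArity t = ys.length) (v : ℕ → U) :
    Fin (σ.predArity t) → U := fun i => v (ys.get (Fin.cast har i))

section Project

variable {R : Rule σ} {xs : Set ℕ} {t : σ.PredSym} {ys : List ℕ}
  {har : σ.predArity t = ys.length}

theorem tupleAt_eq_iff {v w : ℕ → U} :
    tupleAt har v = tupleAt har w ↔ ∀ n ∈ ys, v n = w n := by
  refine ⟨fun h n hn => ?_, fun h => funext fun i => h _ (List.get_mem ..)⟩
  obtain ⟨i, rfl⟩ := List.get_of_mem hn
  exact congrFun h (Fin.cast har.symm i)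

theorem Rule.head_project_snd {H : PredAssign σ U} {v : ℕ → U} :
    (R.project xs t ys har).2.Head φ H v ↔ H t (tupleAt har v) := by
  rw [Rule.Head, Rule.exists_mem_head_project_snd]
  rfl

theorem Rule.bodyFresh_project_snd (h : t ∉ R.toOpen.preds) :
    (R.project xs t ys har).2.BodyFresh t := by
  obtain ⟨h1, h2, h3⟩ := Rule.bodyFresh_of_notMem h
  exact ⟨fun a ha => h1 a (List.mem_of_mem_filter ha),
    fun a ha => h2 a (List.mem_of_mem_filter ha), fun a ha => h3 a (List.mem_of_mem_filter ha)⟩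

open Classical in
/-- Truth of the conjunctive terms of the body that contain no variable from `xs`. -/
def Rule.RestBody (φ : FunAssign σ U) (xs : Set ℕ) (J H : PredAssign σ U) (v : ℕ → U)
    (R : Rule σ) : Prop :=
  (∀ a ∈ R.pos.filter (fun a => decide ¬(a.fv ∩ xs).Nonempty), a.Holds φ H v) ∧
    (∀ a ∈ R.neg.filter (fun a => decide ¬(a.fv ∩ xs).Nonempty), ¬a.Holds φ J v) ∧
      ∀ a ∈ R.nneg.filter (fun a => decide ¬(a.fv ∩ xs).Nonempty), a.Holds φ J v

theorem Rule.body_project_fst {J H : PredAssign σ U} {v : ℕ → U} :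
    (R.project xs t ys har).1.Body φ J H v ↔ H t (tupleAt har v) ∧ R.RestBody φ xs J H v := by
  unfold Rule.Body Rule.RestBody
  simp only [Rule.project, List.forall_mem_cons, and_assoc]
  rfl

theorem Rule.body_iff_project {J H : PredAssign σ U} {v : ℕ → U} :
    R.Body φ J H v ↔ (R.project xs t ys har).2.Body φ J H v ∧ R.RestBody φ xs J H v := by
  classical
  unfold Rule.Body Rule.RestBody
  rw [forall_mem_iff_filter R.pos (fun a => (a.fv ∩ xs).Nonempty),
    forall_mem_iff_filter R.neg (fun a => (a.fv ∩ xs).Nonempty),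
    forall_mem_iff_filter R.nneg (fun a => (a.fv ∩ xs).Nonempty)]
  simp only [Rule.project]
  tauto

theorem Rule.restBody_congr {J H : PredAssign σ U} {v w : ℕ → U} (h : ∀ n ∉ xs, v n = w n) :
    R.RestBody φ xs J H v ↔ R.RestBody φ xs J H w := by
  classical
  have key : ∀ s : Set ℕ, ¬(s ∩ xs).Nonempty → ∀ n ∈ s, v n = w n :=
    fun s hs n hn => h n fun hx => hs ⟨n, hn, hx⟩
  refine and_congr (forall₂_congr fun a ha => ?_) (and_congr (forall₂_congr fun a ha => ?_)
    (forall₂_congr fun a ha => ?_)) <;>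
    have ha' := key _ (of_decide_eq_true (List.mem_filter.1 ha).2)
  · exact Atom.holds_congr_val ha'
  · exact not_congr (Atom.holds_congr_val ha')
  · exact PAtom.holds_congr_val ha'

theorem Rule.body_project_snd_congr {J H : PredAssign σ U} {v w : ℕ → U}
    (h : ∀ n, n ∈ xs ∨ n ∈ R.alphaVars xs → v n = w n) :
    (R.project xs t ys har).2.Body φ J H v ↔ (R.project xs t ys har).2.Body φ J H w := by
  classical
  refine and_congr (forall₂_congr fun a ha => ?_) (and_congr (forall₂_congr fun a ha => ?_)
    (forall₂_congr fun a ha => ?_)) <;>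
    obtain ⟨ha, hx⟩ := List.mem_filter.1 ha <;> replace hx := of_decide_eq_true hx
  · exact Atom.holds_congr_val fun n hn => h n <|
      or_iff_not_imp_left.2 fun hnx => ⟨hnx, Or.inl ⟨a, ha, hn, hx⟩⟩
  · exact not_congr <| Atom.holds_congr_val fun n hn => h n <|
      or_iff_not_imp_left.2 fun hnx => ⟨hnx, Or.inr (Or.inl ⟨a, ha, hn, hx⟩)⟩
  · exact PAtom.holds_congr_val fun n hn => h n <|
      or_iff_not_imp_left.2 fun hnx => ⟨hnx, Or.inr (Or.inr ⟨a, ha, hn, hx⟩)⟩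

theorem Rule.head_congr_val {H : PredAssign σ U} {v w : ℕ → U}
    (h : ∀ n ∈ R.headVars, v n = w n) : R.Head φ H v ↔ R.Head φ H w :=
  exists_congr fun a => and_congr_right fun ha =>
    PAtom.holds_congr_val fun n hn => h n ⟨a, ha, hn⟩

theorem Rule.HT.of_project {J H : PredAssign σ U} (h1 : (R.project xs t ys har).1.HT φ J H)
    (h2 : (R.project xs t ys har).2.HT φ J H) : R.HT φ J H := fun v hv => by
  obtain ⟨hα, hβ⟩ := Rule.body_iff_project.1 hv
  exact h1 v (Rule.body_project_fst.2 ⟨Rule.head_project_snd.1 (h2 v hα), hβ⟩)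

theorem Rule.HT.project_fst {J H : PredAssign σ U} (hR : R.HT φ J H)
    (hxh : xs ∩ R.headVars = ∅) (hys : {v | v ∈ ys} = R.alphaVars xs)
    (hsup : ∀ a, H t a →
      ∃ w, (R.project xs t ys har).2.Body φ J H w ∧ a = tupleAt har w) :
    (R.project xs t ys har).1.HT φ J H := fun v hv => by
  classical
  obtain ⟨ht, hβ⟩ := Rule.body_project_fst.1 hv
  obtain ⟨w, hw, hvw⟩ := hsup _ ht
  rw [tupleAt_eq_iff] at hvw
  have off : ∀ n ∉ xs, xs.piecewise w v n = v n := fun n hn => Set.piecewise_eq_of_notMem _ _ _ hn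
  have hα : (R.project xs t ys har).2.Body φ J H (xs.piecewise w v) := by
    refine (Rule.body_project_snd_congr fun n hn => ?_).1 hw
    by_cases hx : n ∈ xs
    · rw [Set.piecewise_eq_of_mem _ _ _ hx]
    · rw [off n hx]
      exact (hvw n (hys.ge (hn.resolve_left hx))).symm
  have := hR _ (Rule.body_iff_project.2 ⟨hα, (Rule.restBody_congr off).2 hβ⟩)
  refine (Rule.head_congr_val fun n hn => off n fun hx => ?_).1 this
  exact Set.notMem_empty n (hxh ▸ ⟨hx, hn⟩)

/-- Remove all atoms of the predicate symbol `t`. -/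
def PredAssign.erase (t : σ.PredSym) (I : PredAssign σ U) : PredAssign σ U :=
  fun p a => p ≠ t ∧ I p a

theorem PredAssign.agreeOff_erase (t : σ.PredSym) (I : PredAssign σ U) :
    AgreeOff t (I.erase t) I := fun _ hp _ => and_iff_right hp

/-- Add to `H` the atoms `t(y)` derived, below `J`, by the body of the rule `A`. -/
def PredAssign.derive (φ : FunAssign σ U) (har : σ.predArity t = ys.length) (A : Rule σ)
    (J H : PredAssign σ U) : PredAssign σ U :=
  fun p a => H p a ∨ ∃ v, A.Body φ J H v ∧
    (⟨p, a⟩ : Σ p : σ.PredSym, Fin (σ.predArity p) → U) = ⟨t, tupleAt har v⟩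

theorem PredAssign.agreeOff_derive {A : Rule σ} (J H : PredAssign σ U) :
    AgreeOff t (PredAssign.derive φ har A J H) H := fun _ hp _ =>
  or_iff_left fun ⟨_, _, h⟩ => hp (congrArg Sigma.fst h)

theorem PredAssign.derive_self {A : Rule σ} {J H : PredAssign σ U} (h0 : ∀ a, ¬H t a)
    {a : Fin (σ.predArity t) → U} :
    PredAssign.derive φ har A J H t a ↔ ∃ v, A.Body φ J H v ∧ a = tupleAt har v := by
  simp [PredAssign.derive, h0]

theorem Program.forall_mem_project_iff {F1 F2 : Program σ} {A B : Rule σ} {P : Rule σ → Prop} :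
    (∀ Q ∈ F1 ++ [A, B] ++ F2, P Q) ↔ (∀ Q ∈ F1 ++ F2, P Q) ∧ P A ∧ P B := by
  simp only [List.mem_append, List.mem_cons, List.not_mem_nil, or_false, or_imp, forall_and,
    forall_eq]
  tauto

theorem Program.forall_mem_replace_iff {F1 F2 : Program σ} {A : Rule σ} {P : Rule σ → Prop} :
    (∀ Q ∈ F1 ++ A :: F2, P Q) ↔ (∀ Q ∈ F1 ++ F2, P Q) ∧ P A := by
  simp only [List.mem_append, List.mem_cons, or_imp, forall_and, forall_eq]
  tauto

variable {F1 F2 : Program σ}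

/-- In a stable model of the projected program, `t` holds exactly where it is derived. -/
theorem Program.HTStable.eq_derive (hfresh : ∀ Q ∈ F1 ++ R :: F2, t ∉ Q.toOpen.preds)
    {J : PredAssign σ U}
    (hJ : Program.HTStable φ
      (F1 ++ [(R.project xs t ys har).1, (R.project xs t ys har).2] ++ F2) J) :
    J = PredAssign.derive φ har (R.project xs t ys har).2 (J.erase t) (J.erase t) := by
  obtain ⟨hmod, hmin⟩ := hJ
  obtain ⟨hF, hB, hA⟩ := Program.forall_mem_project_iff.1 hmod
  obtain ⟨fF, fR⟩ := Program.forall_mem_replace_iff.1 hfresh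
  have fA := Rule.bodyFresh_project_snd (xs := xs) (ys := ys) (har := har) fR
  have hE := PredAssign.agreeOff_erase t J
  have h0 : ∀ a, ¬J.erase t t a := fun a h => h.1 rfl
  funext p a
  apply propext
  by_cases hp : p ≠ t
  · rw [PredAssign.agreeOff_derive _ _ p hp, hE p hp]
  obtain rfl := not_not.1 hp
  rw [PredAssign.derive_self h0]
  constructor
  · intro hJa
    by_contra hun
    let H : PredAssign σ U :=
      fun q b => J q b ∧ (⟨q, b⟩ : Σ p : σ.PredSym, Fin (σ.predArity p) → U) ≠ ⟨p, a⟩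
    have hHJ : AgreeOff p H J := fun q hq b => and_iff_left fun h => hq (congrArg Sigma.fst h)
    refine hmin ⟨H, fun q b h => h.1, fun h => (h p a hJa).2 rfl,
      Program.forall_mem_project_iff.2 ⟨fun Q hQ => ?_, fun v hv => ?_, fun v hv => ?_⟩⟩
    · exact (AgreeOff.ht (AgreeOff.refl p J) hHJ (fF Q hQ)).2 (hF Q hQ)
    · exact (AgreeOff.head hHJ fR).2 (hB v (hv.mono fun _ _ h => h.1))
    · rw [Rule.head_project_snd]
      rw [AgreeOff.body (AgreeOff.refl p J) hHJ fA] at hv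
      refine ⟨Rule.head_project_snd.1 (hA v hv), fun h => hun ⟨v, ?_, ?_⟩⟩
      · exact (AgreeOff.body hE hE fA).2 hv
      · simpa using h.symm
  · rintro ⟨v, hv, rfl⟩
    exact Rule.head_project_snd.1 (hA v ((AgreeOff.body hE hE fA).1 hv))

theorem Program.HTStable.erase (hfresh : ∀ Q ∈ F1 ++ R :: F2, t ∉ Q.toOpen.preds)
    (hxh : xs ∩ R.headVars = ∅) (hys : {v | v ∈ ys} = R.alphaVars xs)
    {J : PredAssign σ U}
    (hJ : Program.HTStable φ
      (F1 ++ [(R.project xs t ys har).1, (R.project xs t ys har).2] ++ F2) J) :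
    Program.HTStable φ (F1 ++ R :: F2) (J.erase t) := by
  obtain ⟨hmod, hmin⟩ := hJ
  obtain ⟨hF, hB, hA⟩ := Program.forall_mem_project_iff.1 hmod
  obtain ⟨fF, fR⟩ := Program.forall_mem_replace_iff.1 hfresh
  have fA := Rule.bodyFresh_project_snd (xs := xs) (ys := ys) (har := har) fR
  have hE := PredAssign.agreeOff_erase t J
  refine ⟨Program.forall_mem_replace_iff.2 ⟨fun Q hQ => (hE.ht hE (fF Q hQ)).2 (hF Q hQ),
    (hE.ht hE fR).2 (hB.of_project hA)⟩, ?_⟩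
  rintro ⟨H, hle, hnle, hH⟩
  obtain ⟨hHF, hHR⟩ := Program.forall_mem_replace_iff.1 hH
  have h0 : ∀ a, ¬H t a := fun a h => (hle t a h).1 rfl
  have hD := PredAssign.agreeOff_derive (φ := φ) (har := har) (A := (R.project xs t ys har).2)
    (J.erase t) H
  refine hmin ⟨PredAssign.derive φ har (R.project xs t ys har).2 (J.erase t) H, ?_, fun h => hnle ?_,
    Program.forall_mem_project_iff.2 ⟨fun Q hQ => (hE.symm.ht hD (fF Q hQ)).2 (hHF Q hQ), ?_, ?_⟩⟩
  · rintro p a (h | ⟨v, hv, h⟩)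
    · exact (hle p a h).2
    · cases h
      exact Rule.head_project_snd.1 (hA v ((hE.body hE fA).1 (hv.mono hle)))
  · exact fun p a hp => (hD p hp.1 a).1 (h p a hp.2)
  · refine ((hE.symm.ht hD fR).2 hHR).project_fst hxh hys fun a ha => ?_
    obtain ⟨v, hv, h⟩ := (PredAssign.derive_self h0).1 ha
    exact ⟨v, (hE.body hD.symm fA).1 hv, h⟩
  · intro v hv
    rw [Rule.head_project_snd, PredAssign.derive_self h0]
    exact ⟨v, (hE.symm.body hD fA).1 hv, rfl⟩

theorem Program.HTStable.derive (hfresh : ∀ Q ∈ F1 ++ R :: F2, t ∉ Q.toOpen.preds)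
    (hxh : xs ∩ R.headVars = ∅) (hys : {v | v ∈ ys} = R.alphaVars xs)
    {J : PredAssign σ U} (h0 : ∀ a, ¬J t a) (hJ : Program.HTStable φ (F1 ++ R :: F2) J) :
    Program.HTStable φ
      (F1 ++ [(R.project xs t ys har).1, (R.project xs t ys har).2] ++ F2)
      (PredAssign.derive φ har (R.project xs t ys har).2 J J) := by
  obtain ⟨hmod, hmin⟩ := hJ
  obtain ⟨hF, hR⟩ := Program.forall_mem_replace_iff.1 hmod
  obtain ⟨fF, fR⟩ := Program.forall_mem_replace_iff.1 hfresh
  have fA := Rule.bodyFresh_project_snd (xs := xs) (ys := ys) (har := har) fR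
  have hD := PredAssign.agreeOff_derive (φ := φ) (har := har) (A := (R.project xs t ys har).2) J J
  refine ⟨Program.forall_mem_project_iff.2 ⟨fun Q hQ => (hD.ht hD (fF Q hQ)).2 (hF Q hQ), ?_, ?_⟩,
    ?_⟩
  · refine ((hD.ht hD fR).2 hR).project_fst hxh hys fun a ha => ?_
    obtain ⟨v, hv, h⟩ := (PredAssign.derive_self h0).1 ha
    exact ⟨v, (hD.body hD fA).2 hv, h⟩
  · intro v hv
    rw [Rule.head_project_snd, PredAssign.derive_self h0]
    exact ⟨v, (hD.body hD fA).1 hv, rfl⟩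
  rintro ⟨H, hle, hnle, hH⟩
  obtain ⟨hHF, hHB, hHA⟩ := Program.forall_mem_project_iff.1 hH
  have hE := PredAssign.agreeOff_erase t H
  have hEJ : PredLE (H.erase t) J := fun p a h => (hD p h.1 a).1 (hle p a h.2)
  have hJE : PredLE J (H.erase t) := by
    by_contra hn
    exact hmin ⟨_, hEJ, hn, Program.forall_mem_replace_iff.2
      ⟨fun Q hQ => (hD.ht hE.symm (fF Q hQ)).1 (hHF Q hQ),
        (hD.ht hE.symm fR).1 (hHB.of_project hHA)⟩⟩
  have hJH : AgreeOff t J H := fun p hp a =>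
    ⟨fun h => (hJE p a h).2, fun h => hEJ p a ⟨hp, h⟩⟩
  refine hnle ?_
  rintro p a (h | ⟨v, hv, h⟩)
  · exact (hJE p a h).2
  · cases h
    exact Rule.head_project_snd.1 (hHA v ((hD.symm.body hJH fA).1 hv))

end Project

end HereThere

/-! ### Answer sets in the here-and-there semantics -/

section Interp

variable {S : SymSet σ} (M : SInterp σ S)

theorem Term.eval_eq_value (v : ℕ → M.U) (s : Term σ) : s.eval M v = s.value M.funI v := by
  induction s with
  | var n => rfl
  | fn f a ih => simp only [Term.eval, Term.value, ih]

theorem sat_listAnd (v : ℕ → M.U) (l : List (Formula σ)) :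
    Sat M v (listAnd l) ↔ ∀ F ∈ l, Sat M v F := by
  induction l with
  | nil => simp [listAnd, Formula.top, Sat]
  | cons F l ih =>
    have h : listAnd (F :: l) = .and F (listAnd l) := rfl
    simp [h, Sat, ih]

theorem sat_listOr (v : ℕ → M.U) (l : List (Formula σ)) :
    Sat M v (listOr l) ↔ ∃ F ∈ l, Sat M v F := by
  induction l with
  | nil => simp [listOr, Sat]
  | cons F l ih =>
    have h : listOr (F :: l) = .or F (listOr l) := rfl
    simp [h, Sat, ih]

theorem satStar_listAnd (u : PredAssign σ M.U) (P : Set σ.PredSym) (v : ℕ → M.U)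
    (l : List (Formula σ)) : SatStar M u P v (listAnd l) ↔ ∀ F ∈ l, SatStar M u P v F := by
  induction l with
  | nil => simp [listAnd, Formula.top, SatStar, Sat]
  | cons F l ih =>
    have h : listAnd (F :: l) = .and F (listAnd l) := rfl
    simp [h, SatStar, ih]

theorem satStar_listOr (u : PredAssign σ M.U) (P : Set σ.PredSym) (v : ℕ → M.U)
    (l : List (Formula σ)) : SatStar M u P v (listOr l) ↔ ∃ F ∈ l, SatStar M u P v F := by
  induction l with
  | nil => simp [listOr, SatStar]
  | cons F l ih =>
    have h : listOr (F :: l) = .or F (listOr l) := rfl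
    simp [h, SatStar, ih]

theorem Atom.sat_toFormula (v : ℕ → M.U) (a : Atom σ) :
    Sat M v a.toFormula ↔ a.Holds M.funI M.predI v := by
  cases a <;> simp [Atom.toFormula, Sat, Atom.Holds, Term.eval_eq_value]

theorem PAtom.sat_toFormula (v : ℕ → M.U) (a : PAtom σ) :
    Sat M v a.toFormula ↔ a.Holds M.funI M.predI v := by
  simp [PAtom.toFormula, Sat, PAtom.Holds, Term.eval_eq_value]

theorem Atom.satStar_toFormula (u : PredAssign σ M.U) (v : ℕ → M.U) (a : Atom σ) :
    SatStar M u Set.univ v a.toFormula ↔ a.Holds M.funI u v := by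
  cases a <;> simp [Atom.toFormula, SatStar, Atom.Holds, Term.eval_eq_value]

theorem PAtom.satStar_toFormula (u : PredAssign σ M.U) (v : ℕ → M.U) (a : PAtom σ) :
    SatStar M u Set.univ v a.toFormula ↔ a.Holds M.funI u v := by
  simp [PAtom.toFormula, SatStar, PAtom.Holds, Term.eval_eq_value]

theorem Rule.sat_toOpen (v : ℕ → M.U) (R : Rule σ) :
    Sat M v R.toOpen ↔ (R.Body M.funI M.predI M.predI v → R.Head M.funI M.predI v) := by
  simp only [Rule.toOpen, Sat, sat_listAnd, sat_listOr, List.forall_mem_append,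
    List.mem_map, forall_exists_index, and_imp, forall_apply_eq_imp_iff₂,
    exists_exists_and_eq_and, Formula.neg,
    Atom.sat_toFormula, PAtom.sat_toFormula, Rule.Body, Rule.Head, imp_false, not_not, and_assoc]

theorem Rule.satStar_toOpen {u : PredAssign σ M.U} (hu : PredLE u M.predI) (v : ℕ → M.U)
    (R : Rule σ) :
    SatStar M u Set.univ v R.toOpen ↔
      (R.Body M.funI M.predI u v → R.Head M.funI u v) ∧ Sat M v R.toOpen := by
  have hneg : ∀ a : Atom σ,
      (¬a.Holds M.funI u v ∧ ¬a.Holds M.funI M.predI v) ↔ ¬a.Holds M.funI M.predI v :=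
    fun a => and_iff_right_of_imp fun h ha => h (ha.mono hu)
  have hnneg : ∀ a : PAtom σ,
      (¬(¬a.Holds M.funI u v ∧ ¬a.Holds M.funI M.predI v) ∧ a.Holds M.funI M.predI v) ↔
        a.Holds M.funI M.predI v := fun a => by tauto
  simp only [Rule.toOpen, SatStar, Sat, satStar_listAnd, satStar_listOr, List.forall_mem_append,
    List.mem_map, forall_exists_index, and_imp, forall_apply_eq_imp_iff₂,
    exists_exists_and_eq_and, Formula.neg,
    Atom.sat_toFormula, PAtom.sat_toFormula, Atom.satStar_toFormula, PAtom.satStar_toFormula,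
    Rule.Body, Rule.Head, imp_false, not_not, hneg, hnneg, and_assoc]

end Interp

/-- The predicate assignment given by a set of ground atoms. -/
def HAtom.rel {S : SymSet σ} (X : Set (HAtom σ S)) : PredAssign σ (GTerm σ S.funs) :=
  fun p a => ∃ hp : p ∈ S.preds, (⟨⟨p, a⟩, hp⟩ : HAtom σ S) ∈ X

theorem HAtom.exists_rel_eq {S : SymSet σ} {I : PredAssign σ (GTerm σ S.funs)}
    (hI : ∀ p a, I p a → p ∈ S.preds) : ∃ X : Set (HAtom σ S), HAtom.rel X = I :=
  ⟨{x | I x.1.1 x.1.2}, funext₂ fun p a => propext ⟨fun h => h.2, fun h => ⟨hI p a h, h⟩⟩⟩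

theorem HAtom.rel_le_iff {S : SymSet σ} {X Y : Set (HAtom σ S)} :
    PredLE (HAtom.rel X) (HAtom.rel Y) ↔ X ⊆ Y :=
  ⟨fun h x hx => (h x.1.1 x.1.2 ⟨x.2, hx⟩).2, fun h _ _ ⟨hp, hx⟩ => ⟨hp, h hx⟩⟩

open Classical in
/-- Herbrand interpretation of the function symbols. -/
noncomputable def herbFun (Fs : Set σ.FunSym) (ne : Nonempty (GTerm σ Fs)) :
    FunAssign σ (GTerm σ Fs) :=
  fun f a => if hf : f ∈ Fs then GTerm.fn f hf a else Classical.choice ne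

theorem isAnswerSet_iff_htStable {S : SymSet σ} {ne : Nonempty (GTerm σ S.funs)}
    {Pg : Program σ} {X : Set (HAtom σ S)} :
    IsAnswerSet S ne Pg X ↔ Pg.HTStable (herbFun S.funs ne) (HAtom.rel X) := by
  have hsat : (∀ R ∈ Pg, ∀ v, Sat (herbInterp S ne X) v R.toOpen) ↔
      ∀ R ∈ Pg, R.HT (herbFun S.funs ne) (HAtom.rel X) (HAtom.rel X) :=
    forall₂_congr fun R _ => forall_congr' fun v => Rule.sat_toOpen (herbInterp S ne X) v R
  have hstar (h : ∀ R ∈ Pg, ∀ v, Sat (herbInterp S ne X) v R.toOpen) (Y : Set (HAtom σ S))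
      (hY : Y ⊆ X) :
      (∀ R ∈ Pg, ∀ v, SatStar (herbInterp S ne X) (HAtom.rel Y) Set.univ v R.toOpen) ↔
        ∀ R ∈ Pg, R.HT (herbFun S.funs ne) (HAtom.rel X) (HAtom.rel Y) :=
    forall₂_congr fun R hR => forall_congr' fun v =>
      (Rule.satStar_toOpen (herbInterp S ne X) (HAtom.rel_le_iff.2 hY) v R).trans
        (and_iff_left (h R hR v))
  unfold IsAnswerSet Program.HTStable
  rw [← hsat]
  refine and_congr_right fun h => not_congr ⟨?_, ?_⟩
  · rintro ⟨Y, hYX, hY⟩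
    exact ⟨HAtom.rel Y, HAtom.rel_le_iff.2 hYX.1, fun hn => hYX.2 (HAtom.rel_le_iff.1 hn),
      (hstar h Y hYX.1).1 hY⟩
  · rintro ⟨H, hle, hnle, hH⟩
    obtain ⟨Y, rfl⟩ := HAtom.exists_rel_eq fun p a ha => (hle p a ha).1
    have hYX := HAtom.rel_le_iff.1 hle
    exact ⟨Y, ⟨hYX, fun hn => hnle (HAtom.rel_le_iff.2 hn)⟩, (hstar h Y hYX).2 hH⟩

theorem herbInterp_restrict_eq_iff {P P' : Set σ.PredSym} {Fs : Set σ.FunSym} {t : σ.PredSym}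
    (hP : P' = insert t P) (ht : t ∉ P) {ne : Nonempty (GTerm σ Fs)}
    {X' : Set (HAtom σ ⟨P', Fs⟩)} {X : Set (HAtom σ ⟨P, Fs⟩)} :
    (herbInterp ⟨P', Fs⟩ ne X').restrict ⟨P, Fs⟩ = herbInterp ⟨P, Fs⟩ ne X ↔
      (HAtom.rel X').erase t = HAtom.rel X := by
  have key : (fun p a => p ∈ P ∧ HAtom.rel X' p a) = (HAtom.rel X').erase t := by
    funext p a
    refine propext (and_congr_left fun h => ?_)
    have hp : p = t ∨ p ∈ P := by
      obtain ⟨hp, -⟩ := h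
      exact Set.mem_insert_iff.1 (hP ▸ hp)
    exact ⟨fun h1 e => ht (e ▸ h1), hp.resolve_left⟩
  rw [← key]
  constructor
  · intro h
    exact eq_of_heq (SInterp.mk.inj h).2.2
  · intro h
    unfold SInterp.restrict herbInterp
    congr 1
    funext f a
    by_cases hf : f ∈ Fs <;> simp [hf]

/-- The answer sets of a program over the symbols `S`, viewed as Herbrand interpretations. -/
def Program.AnswerModelsOver (S : SymSet σ) (Pg : Program σ) : Set (SInterp σ S) :=
  {M | ∃ (ne : Nonempty (GTerm σ S.funs)) (X : Set (HAtom σ S)),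
    M = herbInterp S ne X ∧ IsAnswerSet S ne Pg X}

theorem consExt_project {F1 F2 : Program σ} {R : Rule σ} {xs : Set ℕ} {t : σ.PredSym}
    {ys : List ℕ} {har : σ.predArity t = ys.length}
    (hfresh : ∀ Q ∈ F1 ++ R :: F2, t ∉ Q.toOpen.preds)
    (hxh : xs ∩ R.headVars = ∅) (hys : {v | v ∈ ys} = R.alphaVars xs)
    {S S' : SymSet σ} (hpreds : S'.preds = insert t S.preds) (hfuns : S'.funs = S.funs)
    (ht : t ∉ S.preds) :
    ConsExt
      (Program.AnswerModelsOver S'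
        (F1 ++ [(R.project xs t ys har).1, (R.project xs t ys har).2] ++ F2))
      (Program.AnswerModelsOver S (F1 ++ R :: F2)) := by
  obtain ⟨P, Fs⟩ := S
  obtain ⟨P', Fs'⟩ := S'
  dsimp only at hpreds hfuns ht
  subst hfuns
  constructor
  · rintro _ ⟨ne, X', rfl, hX'⟩
    obtain ⟨X, hX⟩ := HAtom.exists_rel_eq (S := ⟨P, Fs'⟩) (I := (HAtom.rel X').erase t)
      fun p a h => Set.mem_of_mem_insert_of_ne (hpreds ▸ h.2.1) h.1
    refine ⟨ne, X, (herbInterp_restrict_eq_iff hpreds ht).2 hX.symm, ?_⟩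
    rw [isAnswerSet_iff_htStable] at hX' ⊢
    rw [hX]
    exact hX'.erase hfresh hxh hys
  · rintro _ ⟨ne, X, rfl, hX⟩
    rw [isAnswerSet_iff_htStable] at hX
    have h0 : ∀ a, ¬HAtom.rel X t a := fun a h => ht h.1
    obtain ⟨X', hX'⟩ := HAtom.exists_rel_eq (S := ⟨P', Fs'⟩)
      (I := PredAssign.derive (herbFun Fs' ne) har (R.project xs t ys har).2
        (HAtom.rel (S := ⟨P, Fs'⟩) X) (HAtom.rel (S := ⟨P, Fs'⟩) X)) (by
        rintro p a (h | ⟨v, -, h⟩)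
        · exact hpreds ▸ Or.inr h.1
        · exact hpreds ▸ Or.inl (congrArg Sigma.fst h))
    refine ⟨herbInterp ⟨P', Fs'⟩ ne X', ⟨⟨ne, X', rfl, ?_⟩, ?_⟩, ?_⟩
    · rw [isAnswerSet_iff_htStable, hX']
      exact hX.derive hfresh hxh hys h0
    · rw [herbInterp_restrict_eq_iff hpreds ht, hX']
      funext p a
      refine propext ⟨fun h => (PredAssign.agreeOff_derive _ _ p h.1 a).1 h.2, fun h => ?_⟩
      exact ⟨fun e => ht (e ▸ h.1), Or.inl h⟩
    · rintro _ ⟨⟨_, Y, rfl, hY⟩, hres⟩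
      rw [isAnswerSet_iff_htStable] at hY
      have hYX := (herbInterp_restrict_eq_iff hpreds ht).1 hres
      have hrel : HAtom.rel Y = HAtom.rel X' := by
        rw [hX', hY.eq_derive hfresh, hYX]
      rw [show Y = X' from (HAtom.rel_le_iff.1 fun p a => (hrel ▸ id)).antisymm
        (HAtom.rel_le_iff.1 fun p a => (hrel ▸ id))]

/-- **Corollary 1 (projection for traditional programs).** Let `Pg = F1 ++ R :: F2`
be a traditional program containing at least one object constant, and `xs` a
nonempty tuple of variables occurring in the body of the rule `R` but not in its
head. If `Pg'` is obtained from `Pg` by replacing `R` with the result of projecting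
`xs` out of `R` using a predicate symbol `t` that does not occur in `Pg`, then `Pg'`
is a conservative extension of `Pg`: `M ↦ M|σ(Pg)` is a 1-1 correspondence between
the answer sets of `Pg'` and the answer sets of `Pg`. -/
theorem projection_program {σ : Signature} (F1 F2 : Program σ) (R : Rule σ)
    (hc : ∃ f ∈ (Program.syms (F1 ++ R :: F2)).funs, σ.funArity f = 0)
    (xs : Set ℕ) (hxne : xs.Nonempty) (hxb : xs ⊆ Rule.bodyVars R)
    (hxh : xs ∩ Rule.headVars R = ∅)
    (t : σ.PredSym) (ht : t ∉ Program.preds (F1 ++ R :: F2))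
    (ys : List ℕ) (hnd : ys.Nodup) (hys : {v | v ∈ ys} = Rule.alphaVars R xs)
    (har : σ.predArity t = ys.length) :
    ConsExt
      (Program.AnswerModels
        (F1 ++ [(Rule.project R xs t ys har).1, (Rule.project R xs t ys har).2] ++ F2))
      (Program.AnswerModels (F1 ++ R :: F2)) := by
  have hfresh : ∀ Q ∈ F1 ++ R :: F2, t ∉ Q.toOpen.preds := fun Q hQ h => ht ⟨Q, hQ, h⟩
  refine consExt_project hfresh hxh hys (Set.ext fun p => ?_) (Set.ext fun f => ?_) ht
  · have h := R.mem_preds_project xs t ys har p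
    simp only [Program.syms, Program.preds, Set.mem_ofPred_eq, Set.mem_insert_iff,
      List.mem_append, List.mem_cons, List.not_mem_nil, or_false, or_and_right, exists_or,
      exists_eq_left]
    grind
  · have h := R.mem_funs_project xs t ys har f
    simp only [Program.syms, Program.funs, Set.mem_ofPred_eq,
      List.mem_append, List.mem_cons, List.not_mem_nil, or_false, or_and_right, exists_or,
      exists_eq_left]
    grind

end ASP
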